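/- arXiv:1704.08251 — 2 statements merged into one kernel-verified Lean document; each statement's English description precedes it below -/
import Mathlib

section
/- Let A be the 4×4 Cartan matrix of F₄ with rows r₁ = (2,−1,0,0), r₂ = (−1,2,−2,0), r₃ = (0,−1,2,−1), r₄ = (0,0,−1,2). For i = 1,…,4 define the simple reflection sᵢ : ℝ⁴ → ℝ⁴ by sᵢ(μ) = μ − μᵢ·rᵢ, where μᵢ is the i-th coordinate of μ. Let Φ ⊂ ℝ⁴ be the union of the orbit of (1,0,0,0) and the orbit of (0,0,0,1) under the group generated by s₁,…,s₄ (the 48 roots of F₄ in Dynkin-label coordinates), and let Φₛ be the orbit of (0,0,0,1) (the 24 short roots). For μ, φ ∈ ℝ⁴ write ⟨μ,φ⟩ = μ₁φ₁ + μ₂φ₂ + μ₃φ₃ + μ₄φ₄. Then for all real numbers n52, n26 and every φ = (φ₁,φ₂,φ₃,φ₄) ∈ ℝ⁴ satisfying 2φ₁−φ₂ ≥ 0, −φ₁+2φ₂−2φ₃ ≥ 0, −φ₂+2φ₃−φ₄ ≥ 0 and −φ₃+2φ₄ ≥ 0 (the closed fundamental Weyl chamber), one has (1/2)·( (1−n52)·Σ_{α∈Φ}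 |⟨α,φ⟩|³ − n26·Σ_{w∈Φₛ} |⟨w,φ⟩|³ ) = −8(n52−1)φ₁³ − 8(n52−1)φ₂³ − 8(n52+n26−1)φ₃³ − 8(n52+n26−1)φ₄³ − 3(−n52+n26+1)φ₁²φ₂ + 3(n52+n26−1)φ₁φ₂² + 12(−n52+n26+1)φ₂φ₃² − 6(−3n52+n26+3)φ₂²φ₃ + 6(−3n52+n26+3)φ₃φ₄² + 24(n52−1)φ₃²φ₄. -/
open scoped BigOperators

/-- The rows of the Cartan matrix of F₄ (real coefficients). -/
def cartanF4Row : Fin 4 → Fin 4 → ℝ :=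
  ![![2, -1, 0, 0], ![-1, 2, -2, 0], ![0, -1, 2, -1], ![0, 0, -1, 2]]

/-- The `i`-th simple reflection in Dynkin-label coordinates:
`sᵢ(μ) = μ − μᵢ · rᵢ`, where `rᵢ` is the `i`-th row of the Cartan matrix. -/
def reflF4 (i : Fin 4) (μ : Fin 4 → ℝ) : Fin 4 → ℝ := μ - μ i • cartanF4Row i

lemma reflF4_involutive (i : Fin 4) : Function.Involutive (reflF4 i) := by
  intro μ
  have h : cartanF4Row i i = 2 := by fin_cases i <;> norm_num [cartanF4Row]
  funext j
  simp only [reflF4, Pi.sub_apply, Pi.smul_apply, smul_eq_mul, h]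
  ring

/-- The `i`-th simple reflection of F₄ as a permutation of `ℝ⁴`. -/
def simpleReflF4 (i : Fin 4) : Equiv.Perm (Fin 4 → ℝ) :=
  Function.Involutive.toPerm (reflF4 i) (reflF4_involutive i)

/-- The group generated by the four simple reflections (the Weyl group of F₄ acting in
Dynkin-label coordinates). -/
def weylF4 : Subgroup (Equiv.Perm (Fin 4 → ℝ)) :=
  Subgroup.closure (Set.range simpleReflF4)

/-- The 48 roots of F₄: the union of the Weyl orbits of `(1,0,0,0)` and `(0,0,0,1)`. -/
def rootsF4 : Set (Fin 4 → ℝ) :=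
  MulAction.orbit weylF4 (![1, 0, 0, 0] : Fin 4 → ℝ) ∪
    MulAction.orbit weylF4 (![0, 0, 0, 1] : Fin 4 → ℝ)

/-- The 24 short roots of F₄: the Weyl orbit of `(0,0,0,1)` (the nonzero weights of the
fundamental representation **26**). -/
def shortRootsF4 : Set (Fin 4 → ℝ) :=
  MulAction.orbit weylF4 (![0, 0, 0, 1] : Fin 4 → ℝ)

/-- The Cartan matrix of F₄ with integer entries. -/
def cartanF4Int : Fin 4 → Fin 4 → ℤ :=
  ![![2, -1, 0, 0], ![-1, 2, -2, 0], ![0, -1, 2, -1], ![0, 0, -1, 2]]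

/-- The simple reflections on the weight lattice `ℤ⁴`. -/
def reflF4Int (i : Fin 4) (v : Fin 4 → ℤ) : Fin 4 → ℤ := fun j => v j - v i * cartanF4Int i j

/-- The inclusion of the weight lattice `ℤ⁴` in `ℝ⁴`. -/
def weightF4 (v : Fin 4 → ℤ) : Fin 4 → ℝ := fun j => v j

/-- The height functional, equal to `1` on each simple root. -/
def heightF4 (v : Fin 4 → ℤ) : ℤ := 11 * v 0 + 21 * v 1 + 15 * v 2 + 8 * v 3

/-- The positive long roots. -/
def posLongF4 : List (Fin 4 → ℤ) :=
  [![1, 0, 0, 0], ![-1, 1, 0, 0], ![0, -1, 2, 0], ![0, 1, -2, 2],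
    ![1, -1, 0, 2], ![0, 1, 0, -2], ![-1, 0, 0, 2], ![1, -1, 2, -2],
    ![-1, 0, 2, -2], ![1, 1, -2, 0], ![2, -1, 0, 0], ![-1, 2, -2, 0]]

/-- The positive short roots. -/
def posShortF4 : List (Fin 4 → ℤ) :=
  [![0, 0, 0, 1], ![0, 0, 1, -1], ![0, 1, -1, 0], ![1, -1, 1, 0],
    ![1, 0, -1, 1], ![-1, 0, 1, 0], ![-1, 1, -1, 1], ![1, 0, 0, -1],
    ![0, -1, 1, 1], ![-1, 1, 0, -1], ![0, 0, -1, 2], ![0, -1, 2, -1]]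

/-- The vectors of a list together with their negatives. -/
def withNeg (P : List (Fin 4 → ℤ)) : List (Fin 4 → ℤ) := P ++ P.map fun v => -v

lemma weightF4_injective : Function.Injective weightF4 := fun _ _ h =>
  funext fun j => Int.cast_injective (congrFun h j)

lemma reflF4_weightF4 (i : Fin 4) (v : Fin 4 → ℤ) :
    reflF4 i (weightF4 v) = weightF4 (reflF4Int i v) := by
  have h : ∀ j, cartanF4Row i j = (cartanF4Int i j : ℝ) := by
    intro j
    fin_cases i <;> fin_cases j <;> simp [cartanF4Row, cartanF4Int]
  funext j
  simp [reflF4, weightF4, reflF4Int, h]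

lemma reflF4Int_involutive (i : Fin 4) : Function.Involutive (reflF4Int i) := fun v =>
  weightF4_injective <| by
    rw [← reflF4_weightF4, ← reflF4_weightF4, reflF4_involutive]

lemma heightF4_reflF4Int (i : Fin 4) (v : Fin 4 → ℤ) :
    heightF4 (reflF4Int i v) = heightF4 v - v i := by
  fin_cases i <;> simp [heightF4, reflF4Int, cartanF4Int] <;> ring

lemma reflF4_mem_orbit {x y : Fin 4 → ℝ} (i : Fin 4) (h : y ∈ MulAction.orbit weylF4 x) :
    reflF4 i y ∈ MulAction.orbit weylF4 x :=
  MulAction.mem_orbit_of_mem_orbit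
    (⟨simpleReflF4 i, Subgroup.subset_closure ⟨i, rfl⟩⟩ : weylF4) h

lemma orbit_weylF4_subset {T : Set (Fin 4 → ℝ)} {x : Fin 4 → ℝ} (hx : x ∈ T)
    (hT : ∀ i, ∀ y ∈ T, reflF4 i y ∈ T) : MulAction.orbit weylF4 x ⊆ T := by
  rintro _ ⟨⟨g, hg⟩, rfl⟩
  have key : ∀ y ∈ T, g y ∈ T := by
    refine Subgroup.closure_induction'' (p := fun g _ => ∀ y ∈ T, g y ∈ T) ?_ ?_ ?_ ?_ hg
    · rintro _ ⟨i, rfl⟩ y hy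
      exact hT i y hy
    · rintro _ ⟨i, rfl⟩ y hy
      exact hT i y hy
    · exact fun y hy => hy
    · exact fun a b _ _ ha hb y hy => ha _ (hb y hy)
  exact key x hx

/-- A finite set of weights, stable under the simple reflections, whose only dominant element is
`v₀`, is the Weyl orbit of `v₀`. -/
lemma orbit_weylF4_eq (S : List (Fin 4 → ℤ)) (v₀ : Fin 4 → ℤ) (hv₀ : v₀ ∈ S)
    (hS : ∀ i, ∀ v ∈ S, reflF4Int i v ∈ S)
    (hdom : ∀ v ∈ S, v = v₀ ∨ ∃ i, v i < 0)
    (hht : ∀ v ∈ S, heightF4 v ≤ heightF4 v₀) :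
    MulAction.orbit weylF4 (weightF4 v₀) = ↑(S.toFinset.image weightF4) := by
  apply subset_antisymm
  · apply orbit_weylF4_subset
    · simpa using ⟨v₀, hv₀, rfl⟩
    · intro i y hy
      simp only [Finset.coe_image, List.coe_toFinset, Set.mem_image, Set.mem_ofPred_eq] at hy ⊢
      obtain ⟨v, hv, rfl⟩ := hy
      exact ⟨_, hS i v hv, (reflF4_weightF4 i v).symm⟩
  · have key : ∀ n : ℕ, ∀ v ∈ S, heightF4 v₀ - heightF4 v < n →
        weightF4 v ∈ MulAction.orbit weylF4 (weightF4 v₀) := by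
      intro n
      induction n with
      | zero =>
        intro v hv hn
        have := hht v hv
        push_cast at hn
        lia
      | succ n ih =>
        intro v hv hn
        obtain rfl | ⟨i, hi⟩ := hdom v hv
        · exact MulAction.mem_orbit_self _
        · have h := ih _ (hS i v hv) (by rw [heightF4_reflF4Int]; push_cast at hn; lia)
          rw [← reflF4Int_involutive i v, ← reflF4_weightF4]
          exact reflF4_mem_orbit i h
    intro y hy
    simp only [Finset.coe_image, List.coe_toFinset, Set.mem_image, Set.mem_ofPred_eq] at hy
    obtain ⟨v, hv, rfl⟩ := hy
    exact key (heightF4 v₀ - heightF4 v + 1).toNat v hv (by have := hht v hv; lia)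

lemma orbit_long_eq : MulAction.orbit weylF4 (![1, 0, 0, 0] : Fin 4 → ℝ) =
    ↑((withNeg posLongF4).toFinset.image weightF4) := by
  have h : (![1, 0, 0, 0] : Fin 4 → ℝ) = weightF4 ![1, 0, 0, 0] := by
    funext j; fin_cases j <;> simp [weightF4]
  rw [h]
  apply orbit_weylF4_eq <;> decide +kernel

lemma shortRootsF4_eq : shortRootsF4 = ↑((withNeg posShortF4).toFinset.image weightF4) := by
  have h : (![0, 0, 0, 1] : Fin 4 → ℝ) = weightF4 ![0, 0, 0, 1] := by
    funext j; fin_cases j <;> simp [weightF4]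
  rw [shortRootsF4, h]
  apply orbit_weylF4_eq <;> decide +kernel

lemma rootsF4_eq :
    rootsF4 = ↑((withNeg (posLongF4 ++ posShortF4)).toFinset.image weightF4) := by
  have h : (withNeg (posLongF4 ++ posShortF4)).toFinset =
      (withNeg posLongF4).toFinset ∪ (withNeg posShortF4).toFinset := by
    ext v
    simp only [withNeg, List.map_append, List.mem_toFinset, List.mem_append, Finset.mem_union]
    tauto
  rw [h, Finset.image_union, Finset.coe_union, ← orbit_long_eq, ← shortRootsF4_eq]
  rfl

lemma finsum_withNeg (P : List (Fin 4 → ℤ)) (hP : (withNeg P).Nodup) (φ : Fin 4 → ℝ) :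
    (∑ᶠ α ∈ (↑((withNeg P).toFinset.image weightF4) : Set (Fin 4 → ℝ)),
      |∑ i, α i * φ i| ^ 3) =
      2 * (P.map fun v => |∑ i, (v i : ℝ) * φ i| ^ 3).sum := by
  rw [finsum_mem_coe_finset, Finset.sum_image weightF4_injective.injOn, List.sum_toFinset _ hP]
  simp only [withNeg, List.map_append, List.map_map, List.sum_append, Function.comp_def, weightF4,
    Pi.neg_apply, Int.cast_neg, neg_mul, Finset.sum_neg_distrib, abs_neg]
  ring

/-- The Intriligator–Morrison–Seiberg one-loop prepotential of the five-dimensional F₄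
gauge theory with `n52` adjoint and `n26` fundamental hypermultiplets: on the closed
fundamental Weyl chamber,
`(1/2)((1 − n52)·Σ_{α∈Φ}|⟨α,φ⟩|³ − n26·Σ_{w∈Φₛ}|⟨w,φ⟩|³)` equals the explicit cubic
polynomial in `φ₁,…,φ₄`. -/
theorem IMS_prepotential_F4 (n52 n26 : ℝ) (φ : Fin 4 → ℝ)
    (h1 : 2 * φ 0 - φ 1 ≥ 0) (h2 : -φ 0 + 2 * φ 1 - 2 * φ 2 ≥ 0)
    (h3 : -φ 1 + 2 * φ 2 - φ 3 ≥ 0) (h4 : -φ 2 + 2 * φ 3 ≥ 0) :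
    (1 / 2) * ((1 - n52) * (∑ᶠ α ∈ rootsF4, |∑ i, α i * φ i| ^ 3)
        - n26 * (∑ᶠ w ∈ shortRootsF4, |∑ i, w i * φ i| ^ 3))
      = -8 * (n52 - 1) * (φ 0) ^ 3 - 8 * (n52 - 1) * (φ 1) ^ 3
        - 8 * (n52 + n26 - 1) * (φ 2) ^ 3 - 8 * (n52 + n26 - 1) * (φ 3) ^ 3
        - 3 * (-n52 + n26 + 1) * (φ 0) ^ 2 * (φ 1)
        + 3 * (n52 + n26 - 1) * (φ 0) * (φ 1) ^ 2
        + 12 * (-n52 + n26 + 1) * (φ 1) * (φ 2) ^ 2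
        - 6 * (-3 * n52 + n26 + 3) * (φ 1) ^ 2 * (φ 2)
        + 6 * (-3 * n52 + n26 + 3) * (φ 2) * (φ 3) ^ 2
        + 24 * (n52 - 1) * (φ 2) ^ 2 * (φ 3) := by
  rw [rootsF4_eq, shortRootsF4_eq, finsum_withNeg _ (by decide +kernel),
    finsum_withNeg _ (by decide +kernel), List.map_append, List.sum_append]
  simp only [posLongF4, posShortF4, List.map_cons, List.map_nil, List.sum_cons, List.sum_nil,
    Fin.sum_univ_four, Matrix.cons_val, Int.cast_neg, Int.cast_one, Int.cast_zero, Int.cast_ofNat]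
  repeat rw [abs_of_nonneg (by linarith)]
  ring
end

section
/- Let A be the 4×4 Cartan matrix of F₄ with rows r₁ = (2,−1,0,0), r₂ = (−1,2,−2,0), r₃ = (0,−1,2,−1), r₄ = (0,0,−1,2), let sᵢ(μ) = μ − μᵢ·rᵢ be the simple reflections on ℝ⁴, and let Φₛ be the orbit of (0,0,0,1) under the group generated by s₁,…,s₄ (the 24 nonzero weights of the representation 26 of F₄ in Dynkin-label coordinates). Then for every w ∈ Φₛ and every φ = (φ₁,φ₂,φ₃,φ₄) ∈ ℝ⁴ satisfying the strict inequalities 2φ₁−φ₂ > 0, −φ₁+2φ₂−2φ₃ > 0, −φ₂+2φ₃−φ₄ > 0 and −φ₃+2φ₄ > 0, one has w₁φ₁ + w₂φ₂ + w₃φ₃ + w₄φ₄ ≠ 0. In other words, none of the hyperplanes ⟨w,φ⟩ = 0 defined by the weights of the representation 26 intersects the interior of the fundamental Weyl chamber, so the five-dimensional F₄ gauge theory with matter in 52 ⊕ 26 has a unique Coulomb phase. -/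
/-- The 24 nonzero weights of the representation **26** of F₄: the Weyl orbit of the
fundamental weight `(0,0,0,1)`. -/
def weights26F4 : Set (Fin 4 → ℝ) :=
  MulAction.orbit weylF4 (![0, 0, 0, 1] : Fin 4 → ℝ)

/-- The quadratic form of the F₄ root lattice in simple-root coordinates, normalized to take the
value `1` on short roots. -/
def rootFormF4 (a b c d : ℤ) : ℤ :=
  2 * a ^ 2 + 2 * b ^ 2 + c ^ 2 + d ^ 2 - 2 * a * b - 2 * b * c - c * d

lemma twelve_mul_rootFormF4 (a b c d : ℤ) :
    12 * rootFormF4 a b c d =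
      6 * (2 * a - b) ^ 2 + 2 * (3 * b - 2 * c) ^ 2 + (2 * c - 3 * d) ^ 2 + 3 * d ^ 2 := by
  simp only [rootFormF4]
  ring

lemma rootFormF4_nonneg (a b c d : ℤ) : 0 ≤ rootFormF4 a b c d := by
  have h := twelve_mul_rootFormF4 a b c d
  have : 0 ≤ 12 * rootFormF4 a b c d := by rw [h]; positivity
  linarith

lemma eq_zero_of_rootFormF4_eq_zero {a b c d : ℤ} (h : rootFormF4 a b c d = 0) :
    a = 0 ∧ b = 0 ∧ c = 0 ∧ d = 0 := by
  have e := twelve_mul_rootFormF4 a b c d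
  rw [h] at e
  have h₁ := sq_nonneg (2 * a - b)
  have h₂ := sq_nonneg (3 * b - 2 * c)
  have h₃ := sq_nonneg (2 * c - 3 * d)
  have h₄ := sq_nonneg d
  have e₁ : 2 * a - b = 0 := pow_eq_zero_iff two_ne_zero |>.mp (by linarith)
  have e₂ : 3 * b - 2 * c = 0 := pow_eq_zero_iff two_ne_zero |>.mp (by linarith)
  have e₃ : 2 * c - 3 * d = 0 := pow_eq_zero_iff two_ne_zero |>.mp (by linarith)
  have e₄ : d = 0 := pow_eq_zero_iff two_ne_zero |>.mp (by linarith)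
  omega

/-- The form is superadditive on positive and negative parts, because distinct simple roots meet
at non-acute angles. -/
lemma rootFormF4_posPart_add_negPart_le (a b c d : ℤ) :
    rootFormF4 a⁺ b⁺ c⁺ d⁺ + rootFormF4 a⁻ b⁻ c⁻ d⁻ ≤ rootFormF4 a b c d := by
  have key (x y : ℤ) : x * y ≤ x⁺ * y⁺ + x⁻ * y⁻ := by
    have h₁ := mul_nonneg (posPart_nonneg x) (negPart_nonneg y)
    have h₂ := mul_nonneg (negPart_nonneg x) (posPart_nonneg y)
    conv_lhs => rw [← posPart_sub_negPart x, ← posPart_sub_negPart y]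
    linarith
  have sq (x : ℤ) : x ^ 2 = x⁺ ^ 2 + x⁻ ^ 2 := by
    rcases le_total 0 x with h | h <;> simp [h]
  have hab := key a b
  have hbc := key b c
  have hcd := key c d
  simp only [rootFormF4]
  linarith [sq a, sq b, sq c, sq d]

/-- A short root has simple-root coordinates all nonnegative or all nonpositive. -/
lemma sign_of_rootFormF4_eq_one {a b c d : ℤ} (h : rootFormF4 a b c d = 1) :
    (0 ≤ a ∧ 0 ≤ b ∧ 0 ≤ c ∧ 0 ≤ d) ∨ (a ≤ 0 ∧ b ≤ 0 ∧ c ≤ 0 ∧ d ≤ 0) := by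
  have hle := rootFormF4_posPart_add_negPart_le a b c d
  have hpos := rootFormF4_nonneg a⁺ b⁺ c⁺ d⁺
  have hneg := rootFormF4_nonneg a⁻ b⁻ c⁻ d⁻
  have hor : rootFormF4 a⁻ b⁻ c⁻ d⁻ = 0 ∨ rootFormF4 a⁺ b⁺ c⁺ d⁺ = 0 := by omega
  refine hor.imp (fun h0 => ?_) (fun h0 => ?_)
  · simpa only [negPart_eq_zero] using eq_zero_of_rootFormF4_eq_zero h0
  · simpa only [posPart_eq_zero] using eq_zero_of_rootFormF4_eq_zero h0

/-- `w` is an integral combination of simple roots on which the root form takes the value `1`. -/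
def IsShortRootF4 (w : Fin 4 → ℝ) : Prop :=
  ∃ a b c d : ℤ, rootFormF4 a b c d = 1 ∧
    w = ![2 * (a : ℝ) - b, -a + 2 * b - c, -2 * b + 2 * c - d, -c + 2 * d]

lemma IsShortRootF4.simpleRefl {w : Fin 4 → ℝ} (hw : IsShortRootF4 w) (i : Fin 4) :
    IsShortRootF4 (reflF4 i w) := by
  obtain ⟨a, b, c, d, h, rfl⟩ := hw
  simp only [rootFormF4] at h
  fin_cases i
  · refine ⟨b - a, b, c, d, by simp only [rootFormF4]; linarith, ?_⟩
    funext j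
    fin_cases j <;> simp [reflF4, cartanF4Row] <;> ring
  · refine ⟨a, a - b + c, c, d, by simp only [rootFormF4]; linarith, ?_⟩
    funext j
    fin_cases j <;> simp [reflF4, cartanF4Row] <;> ring
  · refine ⟨a, b, 2 * b - c + d, d, by simp only [rootFormF4]; linarith, ?_⟩
    funext j
    fin_cases j <;> simp [reflF4, cartanF4Row] <;> ring
  · refine ⟨a, b, c, c - d, by simp only [rootFormF4]; linarith, ?_⟩
    funext j
    fin_cases j <;> simp [reflF4, cartanF4Row] <;> ring

lemma IsShortRootF4.apply_of_mem_weylF4 {g : Equiv.Perm (Fin 4 → ℝ)} (hg : g ∈ weylF4) :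
    ∀ {w : Fin 4 → ℝ}, IsShortRootF4 w → IsShortRootF4 (g w) := by
  induction hg using Subgroup.closure_induction'' with
  | one => exact fun hw => hw
  | mem g hg =>
    obtain ⟨i, rfl⟩ := hg
    exact fun hw => hw.simpleRefl i
  | inv_mem g hg =>
    obtain ⟨i, rfl⟩ := hg
    exact fun hw => hw.simpleRefl i
  | mul g k _ _ hg hk => exact fun hw => hg (hk hw)

lemma isShortRootF4_of_mem_weights26F4 {w : Fin 4 → ℝ} (hw : w ∈ weights26F4) :
    IsShortRootF4 w := by
  obtain ⟨⟨g, hg⟩, rfl⟩ := hw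
  refine IsShortRootF4.apply_of_mem_weylF4 hg ⟨1, 2, 3, 2, by norm_num [rootFormF4], ?_⟩
  funext j
  fin_cases j <;> norm_num

/-- A nonnegative integral combination of positive reals vanishes only if it is trivial. -/
lemma eq_zero_of_combination_eq_zero {a b c d : ℤ} {x y z t : ℝ}
    (ha : 0 ≤ a) (hb : 0 ≤ b) (hc : 0 ≤ c) (hd : 0 ≤ d)
    (hx : 0 < x) (hy : 0 < y) (hz : 0 < z) (ht : 0 < t)
    (h : a * x + b * y + c * z + d * t = 0) : a = 0 ∧ b = 0 ∧ c = 0 ∧ d = 0 := by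
  have h₁ : 0 ≤ a * x := mul_nonneg (mod_cast ha) hx.le
  have h₂ : 0 ≤ b * y := mul_nonneg (mod_cast hb) hy.le
  have h₃ : 0 ≤ c * z := mul_nonneg (mod_cast hc) hz.le
  have h₄ : 0 ≤ d * t := mul_nonneg (mod_cast hd) ht.le
  have cancel {n : ℤ} {u : ℝ} (hu : 0 < u) (hn : n * u = 0) : n = 0 := by
    simpa [hu.ne'] using hn
  exact ⟨cancel hx (by linarith), cancel hy (by linarith), cancel hz (by linarith),
    cancel ht (by linarith)⟩

/-- No hyperplane `⟨w,φ⟩ = 0` defined by a weight of the representation **26** meets the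
interior of the fundamental Weyl chamber of F₄: the five-dimensional F₄ gauge theory with
matter in `52 ⊕ 26` has a unique Coulomb phase. -/
theorem weights26_no_wall_in_chamber :
    ∀ w ∈ weights26F4, ∀ φ : Fin 4 → ℝ,
      2 * φ 0 - φ 1 > 0 → -φ 0 + 2 * φ 1 - 2 * φ 2 > 0 →
      -φ 1 + 2 * φ 2 - φ 3 > 0 → -φ 2 + 2 * φ 3 > 0 →
      w 0 * φ 0 + w 1 * φ 1 + w 2 * φ 2 + w 3 * φ 3 ≠ 0 := by
  intro w hw φ hx hy hz ht h0
  obtain ⟨a, b, c, d, h, rfl⟩ := isShortRootF4_of_mem_weights26F4 hw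
  have hsum : a * (2 * φ 0 - φ 1) + b * (-φ 0 + 2 * φ 1 - 2 * φ 2) +
      c * (-φ 1 + 2 * φ 2 - φ 3) + d * (-φ 2 + 2 * φ 3) = 0 := by
    simp at h0
    linarith
  have hzero : a = 0 ∧ b = 0 ∧ c = 0 ∧ d = 0 := by
    rcases sign_of_rootFormF4_eq_one h with ⟨ha, hb, hc, hd⟩ | ⟨ha, hb, hc, hd⟩
    · exact eq_zero_of_combination_eq_zero ha hb hc hd hx hy hz ht hsum
    · have hneg := eq_zero_of_combination_eq_zero (neg_nonneg.mpr ha) (neg_nonneg.mpr hb)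
        (neg_nonneg.mpr hc) (neg_nonneg.mpr hd) hx hy hz ht (by push_cast; linarith)
      simpa only [neg_eq_zero] using hneg
  obtain ⟨rfl, rfl, rfl, rfl⟩ := hzero
  norm_num [rootFormF4] at h
end
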